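/- For every even integer n ≥ 8 and every real number x ≥ 3/π, Alt_x(φ_n) ≥ 0, where φ_n is the polynomial function φ_n(y) = y · Σ_{j even, 4 ≤ j ≤ n−4} B_j(y) · ( y²·C_{n−2−j} − C_{n−j} ) and Alt_x(f) := Σ_{k≥0} ((−1)^k/(2k+1)) · f( (−1)^k·x/(2k+1) ) (the series converges for polynomial f). -/

import Mathlib

/-- `C_{2r} = 2·((r−1)!)²/(2r)!` for `r ≥ 1`, the Taylor coefficients of
`4·arcsin(z/2)² = Σ_{r≥1} C_{2r} z^{2r}`. -/
noncomputable def Ccoef (m : ℕ) : ℝ :=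
  2 * ((m / 2 - 1).factorial : ℝ) ^ 2 / (m.factorial : ℝ)

/-- `B_n(x) = Σ x^{2k−2}·Π_{j=1}^k C_{2 i_j}`, the sum over all `k ≥ 1` and all
compositions `(i_1,…,i_k)` of `n/2` into positive parts other than the all-ones
composition (so `B_0 = B_2 = 0`). -/
noncomputable def Bfun (n : ℕ) (x : ℝ) : ℝ :=
  ∑ᶠ p ∈ {p : Σ k : ℕ, Fin k → ℕ |
      1 ≤ p.1 ∧ (∀ j, 0 < p.2 j) ∧ (∑ j, p.2 j) = n / 2 ∧ p.2 ≠ fun _ => 1},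
    x ^ (2 * p.1 - 2) * ∏ j, Ccoef (2 * p.2 j)

/-- `φ_n(y) = y·Σ_{j even, 4 ≤ j ≤ n−4} B_j(y)·(y²·C_{n−2−j} − C_{n−j})`. -/
noncomputable def phiFun (n : ℕ) (y : ℝ) : ℝ :=
  y * ∑ j ∈ (Finset.Icc 4 (n - 4)).filter (fun j => Even j),
    Bfun j y * (y ^ 2 * Ccoef (n - 2 - j) - Ccoef (n - j))

lemma Ccoef_nonneg' (m : ℕ) : 0 ≤ Ccoef m := by
  unfold Ccoef; positivity

lemma Ccoef_step (r : ℕ) (hr : 1 ≤ r) : 4 * Ccoef (2 * r + 2) ≤ Ccoef (2 * r) := by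
  obtain ⟨s, rfl⟩ : ∃ s, r = s + 1 := ⟨r - 1, by omega⟩
  unfold Ccoef
  have h1 : (2 * (s + 1) + 2) / 2 - 1 = s + 1 := by omega
  have h2 : (2 * (s + 1)) / 2 - 1 = s := by omega
  rw [h1, h2, Nat.factorial_succ s, Nat.factorial_succ (2 * (s + 1) + 1),
    Nat.factorial_succ (2 * (s + 1))]
  have hf : (0 : ℝ) < ((2 * (s + 1)).factorial : ℝ) := by positivity
  have hs : (0 : ℝ) < (s.factorial : ℝ) := by positivity
  generalize ((2 * (s + 1)).factorial) = F at *
  generalize s.factorial = G at *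
  push_cast
  rw [← mul_div_assoc, div_le_div_iff₀ (by positivity) hf]
  have h0 : (0 : ℝ) ≤ (s : ℝ) := by positivity
  have key : 4 * ((s : ℝ) + 1) ^ 2 ≤ (2 * ((s : ℝ) + 1) + 1 + 1) * (2 * ((s : ℝ) + 1) + 1) := by
    nlinarith
  have := mul_le_mul_of_nonneg_left key (by positivity : (0 : ℝ) ≤ 2 * (G : ℝ) ^ 2 * F)
  nlinarith [this]

lemma Bset_finite (N : ℕ) : {p : Σ k : ℕ, Fin k → ℕ |
      1 ≤ p.1 ∧ (∀ j, 0 < p.2 j) ∧ (∑ j, p.2 j) = N ∧ p.2 ≠ fun _ => 1}.Finite := by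
  have hfin : (⋃ k ∈ Set.Iic N, (Sigma.mk k) '' (Set.Iic (fun _ : Fin k => N)) :
      Set (Σ k : ℕ, Fin k → ℕ)).Finite := by
    refine Set.Finite.biUnion (Set.finite_Iic N) fun k _ => ?_
    exact (Set.finite_Iic _).image _
  refine hfin.subset ?_
  rintro ⟨k, f⟩ ⟨_, h2, h3, _⟩
  simp only [Set.mem_iUnion]
  refine ⟨k, ?_, f, ?_, rfl⟩
  · have : ∑ j : Fin k, 1 ≤ ∑ j, f j := Finset.sum_le_sum fun j _ => h2 j
    simp at this
    simp at h3
    simp; omega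
  · intro j
    have := Finset.single_le_sum (f := f) (fun i _ => Nat.zero_le _) (Finset.mem_univ j)
    simp at h3
    simp; omega

lemma Bfun_nonneg (n : ℕ) (x : ℝ) : 0 ≤ Bfun n x := by
  unfold Bfun
  rw [finsum_mem_eq_finite_toFinset_sum _ (Bset_finite (n / 2))]
  refine Finset.sum_nonneg fun p _ => mul_nonneg ?_ (Finset.prod_nonneg fun j _ => Ccoef_nonneg' _)
  exact Even.pow_nonneg ⟨p.1 - 1, by omega⟩ _

lemma Bfun_mono (n : ℕ) (x y : ℝ) (h : |x| ≤ |y|) : Bfun n x ≤ Bfun n y := by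
  unfold Bfun
  rw [finsum_mem_eq_finite_toFinset_sum _ (Bset_finite (n / 2)),
    finsum_mem_eq_finite_toFinset_sum _ (Bset_finite (n / 2))]
  refine Finset.sum_le_sum fun p _ => mul_le_mul_of_nonneg_right ?_
    (Finset.prod_nonneg fun j _ => Ccoef_nonneg' _)
  have he : Even (2 * p.1 - 2) := ⟨p.1 - 1, by omega⟩
  rw [← he.pow_abs x, ← he.pow_abs y]
  gcongr

theorem Alt_phi_nonneg (n : ℕ) (hn : 8 ≤ n) (hne : Even n)
    (x : ℝ) (hx : 3 / Real.pi ≤ x) :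
    Summable (fun k : ℕ => ((-1 : ℝ) ^ k / (2 * k + 1)) *
        phiFun n ((-1 : ℝ) ^ k * x / (2 * k + 1))) ∧
    0 ≤ ∑' k : ℕ, ((-1 : ℝ) ^ k / (2 * k + 1)) *
        phiFun n ((-1 : ℝ) ^ k * x / (2 * k + 1)) := by
  have hx9 : (9 / 10 : ℝ) ≤ x := by
    refine le_trans ?_ hx
    rw [le_div_iff₀ Real.pi_pos]
    nlinarith [Real.pi_lt_d2]
  set S := (Finset.Icc 4 (n - 4)).filter (fun j => Even j) with hS
  set T : ℝ := ∑ j ∈ S, Bfun j x * Ccoef (n - j) with hT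
  set U : ℝ := ∑ j ∈ S, Bfun j x * (x ^ 2 * Ccoef (n - 2 - j)) with hU
  have hTn : 0 ≤ T := Finset.sum_nonneg fun j _ => mul_nonneg (Bfun_nonneg _ _) (Ccoef_nonneg' _)
  have hUn : 0 ≤ U := Finset.sum_nonneg fun j _ => mul_nonneg (Bfun_nonneg _ _)
    (mul_nonneg (sq_nonneg _) (Ccoef_nonneg' _))
  have hUT : (81 / 25 : ℝ) * T ≤ U := by
    rw [hT, hU, Finset.mul_sum]
    refine Finset.sum_le_sum fun j hj => ?_
    simp only [hS, Finset.mem_filter, Finset.mem_Icc] at hj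
    obtain ⟨⟨hj1, hj2⟩, a, ha⟩ := hj
    obtain ⟨b, hb⟩ := hne
    have e1 : n - j = 2 * (b - a - 1) + 2 := by omega
    have e2 : n - 2 - j = 2 * (b - a - 1) := by omega
    have hc := Ccoef_step (b - a - 1) (by omega)
    rw [← e1, ← e2] at hc
    have : (81 / 25 : ℝ) * Ccoef (n - j) ≤ x ^ 2 * Ccoef (n - 2 - j) := by
      have h2 : (81 / 100 : ℝ) ≤ x ^ 2 := by nlinarith
      nlinarith [mul_le_mul_of_nonneg_right h2 (Ccoef_nonneg' (n - 2 - j))]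
    nlinarith [mul_le_mul_of_nonneg_left this (Bfun_nonneg j x)]
  set f : ℕ → ℝ := fun k => ((-1 : ℝ) ^ k / (2 * k + 1)) *
        phiFun n ((-1 : ℝ) ^ k * x / (2 * k + 1)) with hf
  -- the inner sum
  set Q : ℝ → ℝ := fun y => ∑ j ∈ S,
    Bfun j y * (y ^ 2 * Ccoef (n - 2 - j) - Ccoef (n - j)) with hQ
  have hphi : ∀ y, phiFun n y = y * Q y := fun y => rfl
  have hQlow : ∀ y, |y| ≤ |x| → -T ≤ Q y := by
    intro y hy
    rw [hT, hQ, ← Finset.sum_neg_distrib]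
    refine Finset.sum_le_sum fun j _ => ?_
    have h1 := mul_le_mul_of_nonneg_right (Bfun_mono j y x hy) (Ccoef_nonneg' (n - j))
    have h2 := mul_nonneg (Bfun_nonneg j y) (mul_nonneg (sq_nonneg y) (Ccoef_nonneg' (n - 2 - j)))
    nlinarith
  have hQup : ∀ y, |y| ≤ |x| → Q y ≤ U := by
    intro y hy
    rw [hU, hQ]
    refine Finset.sum_le_sum fun j _ => ?_
    have h1 := mul_le_mul (Bfun_mono j y x hy)
      (mul_le_mul_of_nonneg_right (sq_le_sq.mpr hy) (Ccoef_nonneg' (n - 2 - j)))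
      (mul_nonneg (sq_nonneg y) (Ccoef_nonneg' (n - 2 - j))) (Bfun_nonneg j x)
    have h2 := mul_nonneg (Bfun_nonneg j y) (Ccoef_nonneg' (n - j))
    nlinarith
  have hyk : ∀ k : ℕ, |(-1 : ℝ) ^ k * x / (2 * k + 1)| ≤ |x| := by
    intro k
    have hk : (0 : ℝ) ≤ k := by positivity
    rw [abs_div, abs_mul, abs_pow, abs_neg, abs_one, one_pow, one_mul,
      abs_of_pos (by positivity : (0 : ℝ) < 2 * k + 1)]
    exact div_le_self (abs_nonneg _) (by linarith)
  have hfk : ∀ k : ℕ, f k = x / (2 * k + 1) ^ 2 * Q ((-1 : ℝ) ^ k * x / (2 * k + 1)) := by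
    intro k
    have hs : ((-1 : ℝ) ^ k) * (-1) ^ k = 1 := by
      rw [← mul_pow]; norm_num
    have hk : (2 * (k : ℝ) + 1) ≠ 0 := by positivity
    simp only [hf, hphi]
    generalize Q _ = q
    calc _ = ((-1 : ℝ) ^ k * (-1) ^ k) * (x / (2 * k + 1) ^ 2 * q) := by field_simp
      _ = _ := by rw [hs, one_mul]
  have hx0 : 0 < x := by linarith
  have hw : ∀ k : ℕ, x / (2 * k + 1) ^ 2 ≤ x * (1 / ((k : ℝ) + 1) ^ 2) := by
    intro k
    rw [mul_one_div]
    have hk : (0 : ℝ) ≤ k := by positivity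
    gcongr
    linarith
  have hw0 : ∀ k : ℕ, 0 ≤ x / (2 * (k : ℝ) + 1) ^ 2 := fun k => by positivity
  have hz : HasSum (fun k : ℕ => 1 / ((k : ℝ) + 1) ^ 2) (Real.pi ^ 2 / 6) := by
    have := (hasSum_nat_add_iff' 1).mpr hasSum_zeta_two
    simpa using this
  have hsum : Summable f := by
    refine Summable.of_norm_bounded (hz.summable.mul_left (x * (T + U))) fun k => ?_
    rw [hfk, Real.norm_eq_abs, abs_mul, abs_of_nonneg (hw0 k)]
    have h1 : |Q ((-1 : ℝ) ^ k * x / (2 * k + 1))| ≤ T + U := by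
      rw [abs_le]
      constructor
      · linarith [hQlow _ (hyk k)]
      · linarith [hQup _ (hyk k)]
    have := mul_le_mul (hw k) h1 (abs_nonneg _) ((hw0 k).trans (hw k))
    linarith
  refine ⟨hsum, ?_⟩
  have hh : HasSum (fun k : ℕ => x * T * (1 / ((k : ℝ) + 1) ^ 2)) (x * T * (Real.pi ^ 2 / 6)) :=
    hz.mul_left _
  have hadd := hsum.hasSum.add hh
  have hxT : 0 ≤ x * T := by positivity
  have hle := le_hasSum hadd 0 (fun k _ => by
    have h1 := mul_le_mul_of_nonneg_left (hQlow _ (hyk k)) (hw0 k)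
    have h2 := mul_le_mul_of_nonneg_right (hw k) hTn
    rw [hfk]
    nlinarith)
  have hf0 : f 0 = x * (U - T) := by
    rw [hfk]
    simp only [hQ, hU, hT, ← Finset.sum_sub_distrib]
    simp [mul_sub]
  rw [hf0] at hle
  norm_num at hle
  have hpi : Real.pi ^ 2 ≤ 10 := by nlinarith [Real.pi_lt_d2, Real.pi_pos]
  nlinarith [mul_le_mul_of_nonneg_left hUT hx0.le, mul_le_mul_of_nonneg_left hpi hxT]
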